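/- Let (u_k, μ_k) be a sequence of pairs in 𝒟 that converges to (u, μ) in 𝒟, and suppose there is an R > 0 such that E(u_k, μ_k) ≤ R for all k. Define P_k(x) = (1/4)∫_ℝ e^{−|x−s|}u_k(s)² ds + (1/4)∫_ℝ e^{−|x−s|} dμ_k(s) and P(x) = (1/4)∫_ℝ e^{−|x−s|}u(s)² ds + (1/4)∫_ℝ e^{−|x−s|} dμ(s). Then P_k converges to P uniformly on every compact subset of ℝ. -/

import Mathlib

open MeasureTheory Filter Set

noncomputable section

/-- An element of the phase space `𝒟`: a pair `(u, μ)` where `u ∈ H¹_loc(ℝ)` (recorded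
together with a derivative `u'`), `μ` is a positive Borel measure dominating
`(u² + u'²) dx` and `υ` is the excess measure, subject to the growth restrictions
at `-∞` and `+∞`. -/
structure PhaseD where
  u : ℝ → ℝ
  u' : ℝ → ℝ
  μ : Measure ℝ
  υ : Measure ℝ
  meas_u' : Measurable u'
  ftc : ∀ a b : ℝ, u b - u a = ∫ x in a..b, u' x
  locInt : LocallyIntegrable u' volume
  locSq : LocallyIntegrable (fun x => (u' x) ^ 2) volume
  decomp : μ = υ + volume.withDensity (fun x => ENNReal.ofReal ((u x) ^ 2 + (u' x) ^ 2))
  minusCond :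
    (∫⁻ s in Iio (0 : ℝ), ENNReal.ofReal (Real.exp (-s) * ((u s) ^ 2 + (u' s) ^ 2))) +
      (∫⁻ s in Iio (0 : ℝ), ENNReal.ofReal (Real.exp (-s)) ∂υ) < ⊤
  plusCond :
    Filter.limsup (fun x : ℝ =>
      ENNReal.ofReal (Real.exp x) *
        ((∫⁻ s in Ioi x, ENNReal.ofReal (Real.exp (-s) * (u s + u' s) ^ 2)) +
          ∫⁻ s in Ici x, ENNReal.ofReal (Real.exp (-s)) ∂υ)) Filter.atTop < ⊤

/-- The function `w̃(x) = -(u(log x) + u'(log x))/x`. -/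
def tildeW (D : PhaseD) : ℝ → ℝ := fun x => -(D.u (Real.log x) + D.u' (Real.log x)) / x

/-- The measure `υ̃`, i.e. the pushforward under `exp` of `e^{-s} dυ(s)`, so that
`υ̃(B) = ∫_{log B} e^{-s} dυ(s)` for Borel `B ⊆ (0,∞)` and `υ̃({0}) = 0`. -/
def tildeV (D : PhaseD) : Measure ℝ :=
  (D.υ.withDensity fun s => ENNReal.ofReal (Real.exp (-s))).map Real.exp

/-- Convergence of a sequence of pairs to a pair in `𝒟`. -/
def ConvD (Dk : ℕ → PhaseD) (D : PhaseD) : Prop :=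
  (∀ x : ℝ, Tendsto (fun k => (Dk k).u x) atTop (nhds (D.u x))) ∧
    ∀ᵐ x : ℝ ∂volume,
      Tendsto (fun k => ∫⁻ s in Iio x, ENNReal.ofReal (Real.exp (-s)) ∂(Dk k).μ) atTop
        (nhds (∫⁻ s in Iio x, ENNReal.ofReal (Real.exp (-s)) ∂D.μ))

/-- The functional `E(u,μ)`. -/
def Efun (D : PhaseD) : ENNReal :=
  ⨆ x : ℝ, ENNReal.ofReal (Real.exp (x / 2)) *
    ((∫⁻ s in Ioi x, ENNReal.ofReal (Real.exp (-s) * (D.u s + D.u' s) ^ 2)) +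
      ∫⁻ s in Ici x, ENNReal.ofReal (Real.exp (-s)) ∂D.υ) ^ (1 / 2 : ℝ)


/-- The function `P(x) = (1/4)∫ e^{-|x-s|}u(s)² ds + (1/4)∫ e^{-|x-s|} dμ(s)`. -/
def Pfun (D : PhaseD) : ℝ → ℝ := fun x =>
  (1 / 4) * (∫ s, Real.exp (-|x - s|) * (D.u s) ^ 2) +
    (1 / 4) * (∫⁻ s, ENNReal.ofReal (Real.exp (-|x - s|)) ∂D.μ).toReal

namespace PhaseD

lemma intervalIntegrable_u' (D : PhaseD) (a b : ℝ) : IntervalIntegrable D.u' volume a b :=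
  (D.locInt.integrableOn_isCompact isCompact_uIcc).intervalIntegrable

lemma u_eq (D : PhaseD) (a : ℝ) : D.u = fun x => D.u a + ∫ t in a..x, D.u' t := by
  funext x
  rw [← D.ftc a x]
  ring

lemma continuous_u (D : PhaseD) : Continuous D.u := by
  rw [D.u_eq 0]
  exact continuous_const.add (intervalIntegral.continuous_primitive D.intervalIntegrable_u' 0)

lemma absolutelyContinuousOnInterval_u (D : PhaseD) (a b : ℝ) :
    AbsolutelyContinuousOnInterval D.u a b := by
  rw [D.u_eq a]
  have h1 : AbsolutelyContinuousOnInterval (fun _ : ℝ => D.u a) a b :=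
    contDiff_const.contDiffOn.absolutelyContinuousOnInterval
  exact h1.add
    ((D.intervalIntegrable_u' a b).absolutelyContinuousOnInterval_intervalIntegral left_mem_uIcc)

lemma ae_hasDerivAt_u (D : PhaseD) : ∀ᵐ x, HasDerivAt D.u (D.u' x) x := by
  filter_upwards [LocallyIntegrable.ae_hasDerivAt_integral D.locInt] with x hx
  rw [D.u_eq 0]
  exact (hx 0).const_add _

/-- Integration of `(e^{-s} u²)'` over `[a, b]`. -/
lemma integral_deriv_exp_mul_sq (D : PhaseD) (a b : ℝ) :
    ∫ s in a..b, Real.exp (-s) * (2 * D.u s * D.u' s - D.u s ^ 2) =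
      Real.exp (-b) * D.u b ^ 2 - Real.exp (-a) * D.u a ^ 2 := by
  have hexp : AbsolutelyContinuousOnInterval (fun s : ℝ => Real.exp (-s)) a b :=
    (Real.contDiff_exp.comp contDiff_neg).contDiffOn.absolutelyContinuousOnInterval
  have hu := D.absolutelyContinuousOnInterval_u a b
  rw [sq (D.u b), sq (D.u a), ← (hexp.fun_mul (hu.fun_mul hu)).integral_deriv_eq_sub]
  apply intervalIntegral.integral_congr_ae
  filter_upwards [D.ae_hasDerivAt_u] with x hx _
  have h1 : HasDerivAt (fun s : ℝ => Real.exp (-s)) (-Real.exp (-x)) x := by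
    simpa using (hasDerivAt_neg x).exp
  rw [(h1.fun_mul (hx.fun_mul hx)).deriv]
  ring

lemma intervalIntegrable_energy (D : PhaseD) (p q r : ℝ) (a b : ℝ) :
    IntervalIntegrable (fun s => Real.exp (-s) *
      (p * D.u s ^ 2 + q * (D.u s * D.u' s) + r * D.u' s ^ 2)) volume a b := by
  have hu := D.continuous_u
  refine IntervalIntegrable.continuousOn_mul ?_ (by fun_prop)
  refine ((Continuous.intervalIntegrable (by fun_prop) a b).add ?_).add ?_
  · exact ((D.intervalIntegrable_u' a b).continuousOn_mul hu.continuousOn).const_mul q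
  · exact (D.locSq.integrableOn_isCompact isCompact_uIcc).intervalIntegrable.const_mul r

lemma energy_inequality (D : PhaseD) {a b : ℝ} (hab : a ≤ b) :
    Real.exp (-b) * D.u b ^ 2 + ∫ s in a..b, Real.exp (-s) * (D.u s ^ 2 + D.u' s ^ 2) ≤
      (∫ s in a..b, Real.exp (-s) * (D.u s + D.u' s) ^ 2) + Real.exp (-a) * D.u a ^ 2 := by
  have h1 := D.intervalIntegrable_energy 1 2 1 a b
  have h2 := D.intervalIntegrable_energy 1 0 1 a b
  have h3 := D.intervalIntegrable_energy (-1) 2 0 a b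
  have h4 := D.integral_deriv_exp_mul_sq a b
  have h5 : ∫ s in a..b, (Real.exp (-s) * (D.u s ^ 2 + D.u' s ^ 2) +
      Real.exp (-s) * (2 * D.u s * D.u' s - D.u s ^ 2)) ≤
      ∫ s in a..b, Real.exp (-s) * (D.u s + D.u' s) ^ 2 := by
    refine intervalIntegral.integral_mono_on hab ?_ ?_ fun s _ => ?_
    · convert h2.add h3 using 2 with s
      ring
    · convert h1 using 2 with s
      ring
    · rw [← mul_add]
      gcongr
      nlinarith [sq_nonneg (D.u s)]
  rw [intervalIntegral.integral_add (by convert h2 using 2 with s; ring)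
    (by convert h3 using 2 with s; ring)] at h5
  linarith

lemma lintegral_energy_inequality (D : PhaseD) {a b : ℝ} (hab : a ≤ b) :
    ENNReal.ofReal (Real.exp (-b) * D.u b ^ 2) +
        ∫⁻ s in Ioc a b, ENNReal.ofReal (Real.exp (-s) * (D.u s ^ 2 + D.u' s ^ 2)) ≤
      (∫⁻ s in Ioc a b, ENNReal.ofReal (Real.exp (-s) * (D.u s + D.u' s) ^ 2)) +
        ENNReal.ofReal (Real.exp (-a) * D.u a ^ 2) := by
  have h1 : IntegrableOn (fun s => Real.exp (-s) * (D.u s + D.u' s) ^ 2) (Ioc a b) := by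
    rw [← intervalIntegrable_iff_integrableOn_Ioc_of_le hab]
    convert D.intervalIntegrable_energy 1 2 1 a b using 2 with s
    ring
  have h2 : IntegrableOn (fun s => Real.exp (-s) * (D.u s ^ 2 + D.u' s ^ 2)) (Ioc a b) := by
    rw [← intervalIntegrable_iff_integrableOn_Ioc_of_le hab]
    convert D.intervalIntegrable_energy 1 0 1 a b using 2 with s
    ring
  have h3 := D.energy_inequality hab
  rw [intervalIntegral.integral_of_le hab, intervalIntegral.integral_of_le hab] at h3
  rw [← ofReal_integral_eq_lintegral_ofReal h1 (.of_forall fun s => by positivity),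
    ← ofReal_integral_eq_lintegral_ofReal h2 (.of_forall fun s => by positivity),
    ← ENNReal.ofReal_add (by positivity) (integral_nonneg fun s => by positivity),
    ← ENNReal.ofReal_add (integral_nonneg fun s => by positivity) (by positivity)]
  exact ENNReal.ofReal_le_ofReal h3

lemma energy_le_of_Efun_le (D : PhaseD) {R : ℝ} (hR : 0 < R) (hE : Efun D ≤ ENNReal.ofReal R)
    (a : ℝ) :
    (∫⁻ s in Ioi a, ENNReal.ofReal (Real.exp (-s) * (D.u s + D.u' s) ^ 2)) +
      ∫⁻ s in Ici a, ENNReal.ofReal (Real.exp (-s)) ∂D.υ ≤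
      ENNReal.ofReal (R ^ 2 * Real.exp (-a)) := by
  have h := (le_iSup (fun x : ℝ => ENNReal.ofReal (Real.exp (x / 2)) *
    ((∫⁻ s in Ioi x, ENNReal.ofReal (Real.exp (-s) * (D.u s + D.u' s) ^ 2)) +
      ∫⁻ s in Ici x, ENNReal.ofReal (Real.exp (-s)) ∂D.υ) ^ (1 / 2 : ℝ)) a).trans hE
  beta_reduce at h
  set S := (∫⁻ s in Ioi a, ENNReal.ofReal (Real.exp (-s) * (D.u s + D.u' s) ^ 2)) +
      ∫⁻ s in Ici a, ENNReal.ofReal (Real.exp (-s)) ∂D.υ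
  have h1 : (ENNReal.ofReal (Real.exp (-a / 2)) * (ENNReal.ofReal (Real.exp (a / 2)) *
      S ^ (1 / 2 : ℝ))) ^ (2 : ℝ) ≤
      (ENNReal.ofReal (Real.exp (-a / 2)) * ENNReal.ofReal R) ^ (2 : ℝ) := by gcongr
  rw [← mul_assoc, ← ENNReal.ofReal_mul (by positivity), ← Real.exp_add,
    show -a / 2 + a / 2 = 0 by ring, Real.exp_zero, ENNReal.ofReal_one, one_mul,
    ← ENNReal.rpow_mul, ← ENNReal.ofReal_mul (by positivity),
    ENNReal.ofReal_rpow_of_nonneg (by positivity) (by norm_num)] at h1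
  norm_num at h1
  refine h1.trans (ENNReal.ofReal_le_ofReal (le_of_eq ?_))
  rw [mul_pow, ← Real.exp_nat_mul, mul_comm]
  congr 2
  push_cast
  ring

end PhaseD

namespace PhaseD

/-- The measure `e^{-s} dμ(s)`. -/
def weightedMeasure (D : PhaseD) : Measure ℝ :=
  D.μ.withDensity fun s => ENNReal.ofReal (Real.exp (-s))

/-- The measure `e^{-s} u(s)² ds`. -/
def weightedSq (D : PhaseD) : Measure ℝ :=
  volume.withDensity fun s => ENNReal.ofReal (Real.exp (-s) * D.u s ^ 2)

lemma weightedMeasure_Iio (D : PhaseD) (x : ℝ) :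
    D.weightedMeasure (Iio x) = ∫⁻ s in Iio x, ENNReal.ofReal (Real.exp (-s)) ∂D.μ :=
  withDensity_apply _ measurableSet_Iio

lemma weightedMeasure_apply (D : PhaseD) {A : Set ℝ} (hA : MeasurableSet A) :
    D.weightedMeasure A = (∫⁻ s in A, ENNReal.ofReal (Real.exp (-s)) ∂D.υ) +
      ∫⁻ s in A, ENNReal.ofReal (Real.exp (-s) * (D.u s ^ 2 + D.u' s ^ 2)) := by
  have hu := D.continuous_u.measurable
  have hu' := D.meas_u'
  rw [weightedMeasure, withDensity_apply _ hA, D.decomp, Measure.restrict_add,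
    lintegral_add_measure, restrict_withDensity hA,
    lintegral_withDensity_eq_lintegral_mul _ (by fun_prop) (by fun_prop)]
  congr 1
  refine lintegral_congr fun s => ?_
  rw [Pi.mul_apply, mul_comm, ENNReal.ofReal_mul (by positivity)]

lemma weightedSq_le (D : PhaseD) : D.weightedSq ≤ D.weightedMeasure := by
  refine Measure.le_iff.2 fun A hA => ?_
  rw [D.weightedMeasure_apply hA, weightedSq, withDensity_apply _ hA]
  refine le_add_left (lintegral_mono fun s => ENNReal.ofReal_le_ofReal ?_)
  gcongr
  nlinarith [sq_nonneg (D.u' s)]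

lemma weightedMeasure_Iio_lt_top (D : PhaseD) : D.weightedMeasure (Iio 0) < ⊤ := by
  rw [D.weightedMeasure_apply measurableSet_Iio, add_comm]
  exact D.minusCond

variable {D : PhaseD} {R : ℝ}

lemma exp_mul_sq_le (hR : 0 < R) (hE : Efun D ≤ ENNReal.ofReal R) {a b : ℝ} (hab : a ≤ b) :
    ENNReal.ofReal (Real.exp (-b) * D.u b ^ 2) ≤
      ENNReal.ofReal (Real.exp (-a) * (R ^ 2 + D.u a ^ 2)) := by
  refine (le_self_add.trans (D.lintegral_energy_inequality hab)).trans ?_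
  rw [mul_add, ENNReal.ofReal_add (by positivity) (by positivity), mul_comm (Real.exp (-a)) (R ^ 2)]
  gcongr
  refine le_trans ?_ (D.energy_le_of_Efun_le hR hE a)
  exact (lintegral_mono_set Ioc_subset_Ioi_self).trans le_self_add

lemma weightedMeasure_Ici_le (hR : 0 < R) (hE : Efun D ≤ ENNReal.ofReal R) (a : ℝ) :
    D.weightedMeasure (Ici a) ≤ ENNReal.ofReal (Real.exp (-a) * (R ^ 2 + D.u a ^ 2)) := by
  have hIoi : ∫⁻ s in Ioi a, ENNReal.ofReal (Real.exp (-s) * (D.u s ^ 2 + D.u' s ^ 2)) ≤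
      (∫⁻ s in Ioi a, ENNReal.ofReal (Real.exp (-s) * (D.u s + D.u' s) ^ 2)) +
        ENNReal.ofReal (Real.exp (-a) * D.u a ^ 2) := by
    have hlim := tendsto_measure_iUnion_atTop (μ := volume.withDensity fun s =>
      ENNReal.ofReal (Real.exp (-s) * (D.u s ^ 2 + D.u' s ^ 2)))
      (antitone_const.Ioc (monotone_id (α := ℝ)) : Monotone fun b => Ioc a b)
    simp only [iUnion_Ioc_right] at hlim
    rw [withDensity_apply _ measurableSet_Ioi] at hlim
    refine le_of_tendsto hlim ?_
    filter_upwards [eventually_ge_atTop a] with b hab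
    rw [Function.comp_apply, withDensity_apply _ measurableSet_Ioc]
    refine (le_add_self.trans (D.lintegral_energy_inequality hab)).trans ?_
    gcongr
    exact Ioc_subset_Ioi_self
  rw [D.weightedMeasure_apply measurableSet_Ici, ← restrict_Ioi_eq_restrict_Ici (μ := volume)]
  refine (add_le_add_right hIoi _).trans ?_
  rw [← add_assoc, mul_add, ENNReal.ofReal_add (by positivity) (by positivity),
    mul_comm (Real.exp (-a)) (R ^ 2), add_comm (lintegral _ _)]
  gcongr
  exact D.energy_le_of_Efun_le hR hE a

lemma weightedMeasure_univ_le (hR : 0 < R) (hE : Efun D ≤ ENNReal.ofReal R) (a : ℝ) :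
    D.weightedMeasure univ ≤
      D.weightedMeasure (Iio a) + ENNReal.ofReal (Real.exp (-a) * (R ^ 2 + D.u a ^ 2)) := by
  rw [← Iio_union_Ici (a := a)]
  exact (measure_union_le _ _).trans (by gcongr; exact weightedMeasure_Ici_le hR hE a)

lemma weightedMeasure_univ_lt_top (hR : 0 < R) (hE : Efun D ≤ ENNReal.ofReal R) :
    D.weightedMeasure univ < ⊤ :=
  (weightedMeasure_univ_le hR hE 0).trans_lt
    (ENNReal.add_lt_top.2 ⟨D.weightedMeasure_Iio_lt_top, ENNReal.ofReal_lt_top⟩)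

end PhaseD

lemma exists_gt_and_lt_of_lintegral_ne_top {f : ℝ → ENNReal} (hint : ∫⁻ x, f x ≠ ⊤)
    {p : ℝ → Prop} (hp : ∀ᵐ x, p x) {ε : ENNReal} (hε : 0 < ε) (X : ℝ) :
    ∃ x > X, p x ∧ f x < ε := by
  by_contra! hcon
  have h1 : ∫⁻ _ in Ioi X, ε ≤ ∫⁻ x in Ioi X, f x := by
    refine lintegral_mono_ae ?_
    filter_upwards [ae_restrict_mem measurableSet_Ioi, ae_restrict_of_ae hp] with x hx hpx
    exact hcon x hx hpx
  rw [setLIntegral_const, Real.volume_Ioi, ENNReal.mul_top hε.ne'] at h1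
  exact hint (top_le_iff.1 (h1.trans (setLIntegral_le_lintegral _ _)))

/-- Convergence of `m k (A ∩ Iio x)` for suitable `x` together with small upper bounds on the
tails `m k (Ici x)` gives convergence of `m k A`. -/
lemma tendsto_measure_of_tail_le {m : ℕ → Measure ℝ} {m₀ : Measure ℝ} {A : Set ℝ}
    {t : ℕ → ℝ → ENNReal} {t₀ : ℝ → ENNReal} {p : ℝ → Prop}
    (hconv : ∀ x, p x → Tendsto (fun k => m k (A ∩ Iio x)) atTop (nhds (m₀ (A ∩ Iio x))))
    (htail : ∀ k x, m k (Ici x) ≤ t k x)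
    (ht : ∀ x, p x → Tendsto (fun k => t k x) atTop (nhds (t₀ x)))
    (hsmall : ∀ X : ℝ, ∀ ε > 0, ∃ x > X, p x ∧ t₀ x < ε) (hfin : m₀ A ≠ ⊤) :
    Tendsto (fun k => m k A) atTop (nhds (m₀ A)) := by
  refine tendsto_order.2 ⟨fun b hb => ?_, fun c hc => ?_⟩
  · have hlim := tendsto_measure_iUnion_atTop (μ := m₀) (s := fun x : ℝ => A ∩ Iio x)
      (monotone_const.inter fun _ _ h => Iio_subset_Iio h)
    rw [← inter_iUnion, iUnion_Iio, inter_univ] at hlim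
    obtain ⟨X, hX⟩ := eventually_atTop.1 (hlim.eventually (lt_mem_nhds hb))
    obtain ⟨x, hx, hpx, -⟩ := hsmall X 1 one_pos
    filter_upwards [(hconv x hpx).eventually (lt_mem_nhds (hX x hx.le))] with k hk
    exact hk.trans_le (measure_mono inter_subset_left)
  · obtain ⟨x, -, hpx, htx⟩ := hsmall 0 (c - m₀ A) (tsub_pos_of_lt hc)
    have hlt : m₀ (A ∩ Iio x) + t₀ x < c :=
      calc m₀ (A ∩ Iio x) + t₀ x ≤ m₀ A + t₀ x := by gcongr; exact inter_subset_left
        _ < m₀ A + (c - m₀ A) := ENNReal.add_lt_add_left hfin htx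
        _ = c := add_tsub_cancel_of_le hc.le
    filter_upwards [((hconv x hpx).add (ht x hpx)).eventually (gt_mem_nhds hlt)] with k hk
    refine lt_of_le_of_lt ?_ hk
    calc m k A ≤ m k (A ∩ Iio x ∪ Ici x) := by
          refine measure_mono fun y hy => ?_
          rcases lt_or_ge y x with h | h
          exacts [.inl ⟨hy, h⟩, .inr h]
      _ ≤ m k (A ∩ Iio x) + t k x := (measure_union_le _ _).trans (by gcongr; exact htail k x)

namespace ConvD

variable {Dk : ℕ → PhaseD} {D : PhaseD} {R : ℝ}

lemma ae_tendsto_weightedMeasure_Iio (h : ConvD Dk D) :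
    ∀ᵐ x : ℝ, Tendsto (fun k => (Dk k).weightedMeasure (Iio x)) atTop
      (nhds (D.weightedMeasure (Iio x))) := by
  simpa only [PhaseD.weightedMeasure_Iio] using h.2

lemma tendsto_tail_bound (h : ConvD Dk D) (R a : ℝ) :
    Tendsto (fun k => ENNReal.ofReal (Real.exp (-a) * (R ^ 2 + (Dk k).u a ^ 2))) atTop
      (nhds (ENNReal.ofReal (Real.exp (-a) * (R ^ 2 + D.u a ^ 2)))) :=
  ENNReal.tendsto_ofReal ((((h.1 a).pow 2).const_add _).const_mul _)

lemma weightedMeasure_univ_lt_top (h : ConvD Dk D) (hR : 0 < R)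
    (hE : ∀ k, Efun (Dk k) ≤ ENNReal.ofReal R) : D.weightedMeasure univ < ⊤ := by
  have hdense := Measure.dense_of_ae h.ae_tendsto_weightedMeasure_Iio
  obtain ⟨a, ha, ha0⟩ := hdense.exists_lt 0
  refine lt_of_le_of_lt (b := D.weightedMeasure (Iio a) +
      ENNReal.ofReal (Real.exp (-a) * (R ^ 2 + D.u a ^ 2))) ?_ ?_
  · have hlim := tendsto_measure_iUnion_atTop (μ := D.weightedMeasure)
      (s := fun x : ℝ => Iio x) (fun _ _ h => Iio_subset_Iio h)
    rw [iUnion_Iio] at hlim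
    refine le_of_tendsto' hlim fun y => ?_
    obtain ⟨x, hx, hyx⟩ := hdense.exists_gt y
    refine (measure_mono (Iio_subset_Iio hyx.le)).trans ?_
    refine le_of_tendsto_of_tendsto' hx (ha.add (h.tendsto_tail_bound R a)) fun k => ?_
    exact (measure_mono (subset_univ _)).trans (PhaseD.weightedMeasure_univ_le hR (hE k) a)
  · exact ENNReal.add_lt_top.2 ⟨(measure_mono (Iio_subset_Iio ha0.le)).trans_lt
      D.weightedMeasure_Iio_lt_top, ENNReal.ofReal_lt_top⟩

lemma exists_tail_bound_lt (h : ConvD Dk D) (hR : 0 < R)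
    (hE : ∀ k, Efun (Dk k) ≤ ENNReal.ofReal R) {p : ℝ → Prop} (hp : ∀ᵐ x, p x) (X : ℝ)
    (ε : ENNReal) (hε : 0 < ε) :
    ∃ x > X, p x ∧ ENNReal.ofReal (Real.exp (-x) * (R ^ 2 + D.u x ^ 2)) < ε := by
  have hlim : Tendsto (fun x : ℝ => ENNReal.ofReal (Real.exp (-x) * R ^ 2)) atTop (nhds 0) := by
    have := (Real.tendsto_exp_neg_atTop_nhds_zero).mul_const (R ^ 2)
    simpa using ENNReal.tendsto_ofReal this
  have hε2 : 0 < ε / 2 := ENNReal.half_pos hε.ne'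
  obtain ⟨Y, hY⟩ := eventually_atTop.1 (hlim.eventually (gt_mem_nhds hε2))
  have hint : ∫⁻ x, ENNReal.ofReal (Real.exp (-x) * D.u x ^ 2) ≠ ⊤ := by
    rw [← setLIntegral_univ, ← withDensity_apply _ MeasurableSet.univ]
    exact ((D.weightedSq_le univ).trans_lt (h.weightedMeasure_univ_lt_top hR hE)).ne
  obtain ⟨x, hx, hpx, hlt⟩ := exists_gt_and_lt_of_lintegral_ne_top hint hp hε2 (max X Y)
  refine ⟨x, (le_max_left _ _).trans_lt hx, hpx, ?_⟩
  rw [mul_add, ENNReal.ofReal_add (by positivity) (by positivity), ← ENNReal.add_halves ε]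
  exact ENNReal.add_lt_add (hY x ((le_max_right _ _).trans hx.le)) hlt

lemma tendsto_weightedMeasure_univ (h : ConvD Dk D) (hR : 0 < R)
    (hE : ∀ k, Efun (Dk k) ≤ ENNReal.ofReal R) :
    Tendsto (fun k => (Dk k).weightedMeasure univ) atTop (nhds (D.weightedMeasure univ)) := by
  refine tendsto_measure_of_tail_le
    (t := fun k x => ENNReal.ofReal (Real.exp (-x) * (R ^ 2 + (Dk k).u x ^ 2)))
    (fun x hx => by simpa only [univ_inter] using hx)
    (fun k x => PhaseD.weightedMeasure_Ici_le hR (hE k) x)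
    (fun x _ => h.tendsto_tail_bound R x)
    (h.exists_tail_bound_lt hR hE h.ae_tendsto_weightedMeasure_Iio)
    (h.weightedMeasure_univ_lt_top hR hE).ne

lemma ae_tendsto_weightedMeasure_Ici (h : ConvD Dk D) (hR : 0 < R)
    (hE : ∀ k, Efun (Dk k) ≤ ENNReal.ofReal R) :
    ∀ᵐ x : ℝ, Tendsto (fun k => (Dk k).weightedMeasure (Ici x)) atTop
      (nhds (D.weightedMeasure (Ici x))) := by
  filter_upwards [h.ae_tendsto_weightedMeasure_Iio] with x hx
  have hfin := h.weightedMeasure_univ_lt_top hR hE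
  have hcompl (m : Measure ℝ) (hm : m univ < ⊤) : m (Ici x) = m univ - m (Iio x) := by
    rw [← compl_Iio, measure_compl measurableSet_Iio
      ((measure_mono (subset_univ _)).trans_lt hm).ne]
  simp only [hcompl _ hfin, fun k => hcompl _ (PhaseD.weightedMeasure_univ_lt_top hR (hE k))]
  exact ENNReal.Tendsto.sub (h.tendsto_weightedMeasure_univ hR hE) hx (.inl hfin.ne)

lemma tendsto_weightedSq_Ico (h : ConvD Dk D) (hR : 0 < R)
    (hE : ∀ k, Efun (Dk k) ≤ ENNReal.ofReal R) (r x : ℝ) :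
    Tendsto (fun k => (Dk k).weightedSq (Ico r x)) atTop (nhds (D.weightedSq (Ico r x))) := by
  simp only [PhaseD.weightedSq, withDensity_apply _ measurableSet_Ico]
  have hcont (D : PhaseD) := D.continuous_u.measurable
  have hlt := (ENNReal.ofReal_lt_top (r := Real.exp (-r) * (R ^ 2 + D.u r ^ 2)))
  refine tendsto_lintegral_filter_of_dominated_convergence
    (fun _ => ENNReal.ofReal (Real.exp (-r) * (R ^ 2 + D.u r ^ 2)) + 1)
    (.of_forall fun k => by have := hcont (Dk k); fun_prop) ?_ ?_ (.of_forall fun s => ?_)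
  · filter_upwards [(h.tendsto_tail_bound R r).eventually
      (gt_mem_nhds (ENNReal.lt_add_right hlt.ne one_ne_zero))] with k hk
    filter_upwards [ae_restrict_mem measurableSet_Ico] with s hs
    exact (PhaseD.exp_mul_sq_le hR (hE k) hs.1).trans hk.le
  · rw [setLIntegral_const, Real.volume_Ico]
    exact ENNReal.mul_ne_top (ENNReal.add_ne_top.2 ⟨hlt.ne, ENNReal.one_ne_top⟩)
      ENNReal.ofReal_ne_top
  · exact ENNReal.tendsto_ofReal (((h.1 s).pow 2).const_mul _)

lemma tendsto_weightedSq_Ici (h : ConvD Dk D) (hR : 0 < R)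
    (hE : ∀ k, Efun (Dk k) ≤ ENNReal.ofReal R) (r : ℝ) :
    Tendsto (fun k => (Dk k).weightedSq (Ici r)) atTop (nhds (D.weightedSq (Ici r))) := by
  refine tendsto_measure_of_tail_le (p := fun _ => True)
    (t := fun k x => ENNReal.ofReal (Real.exp (-x) * (R ^ 2 + (Dk k).u x ^ 2)))
    (fun x _ => ?_)
    (fun k x => ((Dk k).weightedSq_le _).trans (PhaseD.weightedMeasure_Ici_le hR (hE k) x))
    (fun x _ => h.tendsto_tail_bound R x)
    (h.exists_tail_bound_lt hR hE (.of_forall fun _ => trivial)) ?_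
  · simpa only [Ici_inter_Iio] using h.tendsto_weightedSq_Ico hR hE r x
  · exact ((D.weightedSq_le _).trans_lt ((measure_mono (subset_univ _)).trans_lt
      (h.weightedMeasure_univ_lt_top hR hE))).ne

end ConvD

lemma lintegral_exp_sub_abs (ρ : Measure ℝ) [SFinite ρ] (x : ℝ) :
    ∫⁻ s, ENNReal.ofReal (Real.exp (s - |x - s|)) ∂ρ =
      ENNReal.ofReal (2 * Real.exp (-x)) *
        ∫⁻ r in Iic x, ENNReal.ofReal (Real.exp (2 * r)) * ρ (Ici r) := by
  have hpt (s : ℝ) : ENNReal.ofReal (Real.exp (s - |x - s|)) = ENNReal.ofReal (2 * Real.exp (-x)) *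
      ∫⁻ r in Iic x, {q : ℝ × ℝ | q.2 ≤ q.1}.indicator
        (fun q => ENNReal.ofReal (Real.exp (2 * q.2))) (s, r) := by
    have h1 : ∀ r, {q : ℝ × ℝ | q.2 ≤ q.1}.indicator
        (fun q => ENNReal.ofReal (Real.exp (2 * q.2))) (s, r) =
        (Iic s).indicator (fun r => ENNReal.ofReal (Real.exp (2 * r))) r := fun r => rfl
    simp_rw [h1]
    rw [lintegral_indicator measurableSet_Iic, Measure.restrict_restrict measurableSet_Iic,
      Iic_inter_Iic, ← ofReal_integral_eq_lintegral_ofReal (integrableOn_exp_mul_Iic two_pos _)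
        (.of_forall fun r => by positivity), integral_exp_mul_Iic two_pos,
      ← ENNReal.ofReal_mul (by positivity)]
    congr 1
    rw [show 2 * Real.exp (-x) * (Real.exp (2 * (s ⊓ x)) / 2) =
      Real.exp (-x) * Real.exp (2 * (s ⊓ x)) by ring, ← Real.exp_add]
    congr 1
    rcases le_total s x with h | h
    · rw [inf_eq_left.2 h, abs_of_nonneg (by linarith)]
      ring
    · rw [inf_eq_right.2 h, abs_of_nonpos (by linarith)]
      ring
  have hmeas : Measurable ({q : ℝ × ℝ | q.2 ≤ q.1}.indicator
      (fun q => ENNReal.ofReal (Real.exp (2 * q.2)))) :=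
    Measurable.indicator (by fun_prop) (measurableSet_le measurable_snd measurable_fst)
  simp_rw [hpt]
  rw [lintegral_const_mul _ hmeas.lintegral_prod_right', lintegral_lintegral_swap
    (f := fun s r => {q : ℝ × ℝ | q.2 ≤ q.1}.indicator
      (fun q => ENNReal.ofReal (Real.exp (2 * q.2))) (s, r)) hmeas.aemeasurable]
  congr 1
  refine lintegral_congr fun r => ?_
  have h2 : ∀ s, {q : ℝ × ℝ | q.2 ≤ q.1}.indicator
      (fun q => ENNReal.ofReal (Real.exp (2 * q.2))) (s, r) =
      (Ici r).indicator (fun _ => ENNReal.ofReal (Real.exp (2 * r))) s := fun s => rfl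
  simp_rw [h2]
  rw [lintegral_indicator_const measurableSet_Ici]

/-- The potential `∫ e^{s - |x - s|} dρ(s)` of a measure `ρ`. -/
def expPotential (ρ : Measure ℝ) (x : ℝ) : ℝ :=
  (∫⁻ s, ENNReal.ofReal (Real.exp (s - |x - s|)) ∂ρ).toReal

lemma measurable_real_Ici (ρ : Measure ℝ) [IsFiniteMeasure ρ] :
    Measurable fun r => ρ.real (Ici r) :=
  Antitone.measurable fun _ _ h => measureReal_mono (Ici_subset_Ici.2 h)

lemma integrableOn_exp_mul_real_Ici (ρ : Measure ℝ) [IsFiniteMeasure ρ] (x : ℝ) :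
    IntegrableOn (fun r => Real.exp (2 * r) * ρ.real (Ici r)) (Iic x) := by
  refine Integrable.mul_bdd (c := ρ.real univ) (integrableOn_exp_mul_Iic two_pos x)
    (measurable_real_Ici ρ).aestronglyMeasurable (.of_forall fun r => ?_)
  rw [Real.norm_of_nonneg measureReal_nonneg]
  exact measureReal_mono (subset_univ _)

lemma expPotential_eq (ρ : Measure ℝ) [IsFiniteMeasure ρ] (x : ℝ) :
    expPotential ρ x =
      2 * Real.exp (-x) * ∫ r in Iic x, Real.exp (2 * r) * ρ.real (Ici r) := by
  rw [expPotential, lintegral_exp_sub_abs, ENNReal.toReal_mul,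
    ENNReal.toReal_ofReal (by positivity)]
  congr 1
  rw [integral_eq_lintegral_of_nonneg_ae (.of_forall fun r => by positivity)
    (integrableOn_exp_mul_real_Ici ρ x).aestronglyMeasurable]
  congr 1
  refine lintegral_congr fun r => ?_
  rw [ENNReal.ofReal_mul (by positivity), ofReal_measureReal]

lemma tendsto_integral_abs_sub_real_Ici {ρ : ℕ → Measure ℝ} {ρ₀ : Measure ℝ}
    [∀ k, IsFiniteMeasure (ρ k)] [IsFiniteMeasure ρ₀] {M : ℝ}
    (hM : ∀ᶠ k in atTop, (ρ k).real univ ≤ M)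
    (hlim : ∀ᵐ r : ℝ, Tendsto (fun k => ρ k (Ici r)) atTop (nhds (ρ₀ (Ici r)))) (b : ℝ) :
    Tendsto (fun k => ∫ r in Iic b, Real.exp (2 * r) * |(ρ k).real (Ici r) - ρ₀.real (Ici r)|)
      atTop (nhds 0) := by
  rw [← integral_zero ℝ ℝ (μ := volume.restrict (Iic b))]
  refine tendsto_integral_filter_of_dominated_convergence
    (fun r => Real.exp (2 * r) * (M + ρ₀.real univ)) (.of_forall fun k => ?_) ?_
    ((integrableOn_exp_mul_Iic two_pos b).mul_const _) ?_
  · have h1 := measurable_real_Ici (ρ k)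
    have h2 := measurable_real_Ici ρ₀
    exact Measurable.aestronglyMeasurable (by fun_prop)
  · filter_upwards [hM] with k hk
    refine .of_forall fun r => ?_
    rw [Real.norm_of_nonneg (by positivity)]
    gcongr
    refine (abs_sub _ _).trans ?_
    rw [abs_of_nonneg measureReal_nonneg, abs_of_nonneg measureReal_nonneg]
    exact add_le_add ((measureReal_mono (subset_univ _)).trans hk) (measureReal_mono (subset_univ _))
  · filter_upwards [ae_restrict_of_ae hlim] with r hr
    have h1 : Tendsto (fun k => (ρ k).real (Ici r)) atTop (nhds (ρ₀.real (Ici r))) :=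
      (ENNReal.tendsto_toReal (measure_ne_top _ _)).comp hr
    simpa using (h1.sub_const (ρ₀.real (Ici r))).abs.const_mul (Real.exp (2 * r))

lemma tendstoUniformlyOn_expPotential {ρ : ℕ → Measure ℝ} {ρ₀ : Measure ℝ}
    [∀ k, IsFiniteMeasure (ρ k)] [IsFiniteMeasure ρ₀] {M : ℝ}
    (hM : ∀ᶠ k in atTop, (ρ k).real univ ≤ M)
    (hlim : ∀ᵐ r : ℝ, Tendsto (fun k => ρ k (Ici r)) atTop (nhds (ρ₀ (Ici r))))
    {K : Set ℝ} (hK : IsCompact K) :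
    TendstoUniformlyOn (fun k => expPotential (ρ k)) (expPotential ρ₀) atTop K := by
  obtain ⟨a, ha⟩ := hK.bddBelow
  obtain ⟨b, hb⟩ := hK.bddAbove
  rw [Metric.tendstoUniformlyOn_iff]
  intro ε hε
  have h1 := (tendsto_integral_abs_sub_real_Ici hM hlim b).const_mul (2 * Real.exp (-a))
  rw [mul_zero] at h1
  filter_upwards [h1.eventually (gt_mem_nhds hε)] with k hk x hx
  refine lt_of_le_of_lt ?_ hk
  have hint : IntegrableOn
      (fun r => Real.exp (2 * r) * |(ρ k).real (Ici r) - ρ₀.real (Ici r)|) (Iic b) := by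
    have := ((integrableOn_exp_mul_real_Ici (ρ k) b).sub (integrableOn_exp_mul_real_Ici ρ₀ b)).abs
    refine this.congr (.of_forall fun r => ?_)
    simp only [Pi.sub_apply, ← mul_sub, abs_mul, Real.abs_exp]
  rw [dist_comm, Real.dist_eq, expPotential_eq, expPotential_eq, ← mul_sub,
    ← integral_sub (integrableOn_exp_mul_real_Ici _ _) (integrableOn_exp_mul_real_Ici _ _),
    abs_mul, abs_of_pos (by positivity)]
  gcongr
  · exact ha hx
  · refine (abs_integral_le_integral_abs).trans ?_
    simp only [← mul_sub, abs_mul, Real.abs_exp]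
    exact setIntegral_mono_set hint (.of_forall fun r => by positivity)
      (.of_forall (Iic_subset_Iic.2 (hb hx)))

lemma Pfun_eq (D : PhaseD) (x : ℝ) :
    Pfun D x = (1 / 4) * (expPotential D.weightedSq x + expPotential D.weightedMeasure x) := by
  have hu := D.continuous_u.measurable
  rw [Pfun, ← mul_add, expPotential, expPotential, PhaseD.weightedSq, PhaseD.weightedMeasure,
    integral_eq_lintegral_of_nonneg_ae (.of_forall fun s => by positivity)
      (Measurable.aestronglyMeasurable (by fun_prop)),
    lintegral_withDensity_eq_lintegral_mul _ (by fun_prop) (by fun_prop),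
    lintegral_withDensity_eq_lintegral_mul _ (by fun_prop) (by fun_prop)]
  congr! 4 <;> funext s
  · rw [Pi.mul_apply, ← ENNReal.ofReal_mul (by positivity), mul_right_comm, ← Real.exp_add]
    ring_nf
  · rw [Pi.mul_apply, ← ENNReal.ofReal_mul (by positivity), ← Real.exp_add]
    ring_nf

/-- If `(u_k,μ_k) → (u,μ)` in `𝒟` and `E(u_k,μ_k) ≤ R` for all `k`,
then `P_k → P` uniformly on every compact subset of `ℝ`. -/
theorem statement18 (Dk : ℕ → PhaseD) (D : PhaseD) (h : ConvD Dk D)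
    (R : ℝ) (hR : 0 < R) (hE : ∀ k, Efun (Dk k) ≤ ENNReal.ofReal R) :
    ∀ K : Set ℝ, IsCompact K →
      TendstoUniformlyOn (fun k => Pfun (Dk k)) (Pfun D) atTop K := by
  intro K hK
  have hfin := h.weightedMeasure_univ_lt_top hR hE
  have hfink := fun k => PhaseD.weightedMeasure_univ_lt_top hR (hE k)
  have : IsFiniteMeasure D.weightedMeasure := ⟨hfin⟩
  have : ∀ k, IsFiniteMeasure (Dk k).weightedMeasure := fun k => ⟨hfink k⟩
  have : IsFiniteMeasure D.weightedSq := ⟨(D.weightedSq_le _).trans_lt hfin⟩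
  have : ∀ k, IsFiniteMeasure (Dk k).weightedSq :=
    fun k => ⟨((Dk k).weightedSq_le _).trans_lt (hfink k)⟩
  have hM : ∀ᶠ k in atTop, (Dk k).weightedMeasure.real univ ≤ D.weightedMeasure.real univ + 1 :=
    (((ENNReal.tendsto_toReal hfin.ne).comp (h.tendsto_weightedMeasure_univ hR hE)).eventually
      (gt_mem_nhds (lt_add_one _))).mono fun k hk => le_of_lt hk
  have hMsq : ∀ᶠ k in atTop, (Dk k).weightedSq.real univ ≤ D.weightedMeasure.real univ + 1 :=
    hM.mono fun k hk => (ENNReal.toReal_mono (hfink k).ne ((Dk k).weightedSq_le _)).trans hk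
  have hsum := (tendstoUniformlyOn_expPotential hMsq
      (.of_forall (h.tendsto_weightedSq_Ici hR hE)) hK).add
    (tendstoUniformlyOn_expPotential hM (h.ae_tendsto_weightedMeasure_Ici hR hE) hK)
  have hP (D : PhaseD) : Pfun D = (fun y => (1 / 4) * y) ∘
      (expPotential D.weightedSq + expPotential D.weightedMeasure) := funext (Pfun_eq D)
  simp only [hP]
  exact (uniformContinuous_const_smul (1 / 4 : ℝ)).comp_tendstoUniformlyOn hsum

end
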